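/- arXiv:2206.13841 — 3 statements merged into one kernel-verified Lean document; each statement's English description precedes it below -/
import Mathlib

section
/- Let W₁, W₂ ⊆ 𝒰 be epistemic models, c_Ag a variable observable by all agents not in dom(W₁) ∪ dom(W₂), and l, r two distinct values in D. Let W = {s[c_Ag ↦ l] | s ∈ W₁} ∪ {s[c_Ag ↦ r] | s ∈ W₂}. Then for every formula α ∈ L^m_K in which c_Ag does not occur: W ⊨ α if and only if both {s[c_Ag ↦ l] | s ∈ W₁} ⊨ α and {s[c_Ag ↦ r] | s ∈ W₂} ⊨ α, and these in turn hold if and only if W₁ ⊨ α and W₂ ⊨ α (i.e., this union is a disjoint union of multi-agent epistemic models and preserves the truth of epistemic formulas). -/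
namespace PEL

/-- A state is a partial valuation of the variables. -/
abbrev State (Var D : Type) := Var → Option D

variable {Agent Var D : Type}

/-- `upd s x v` updates state `s` at variable `x` to the (possibly undefined) value `v`. -/
def upd [DecidableEq Var] (s : State Var D) (x : Var) (v : Option D) : State Var D :=
  fun y => if y = x then v else s y

/-- The domain of a state. -/
def sdom (s : State Var D) : Set Var := {x | s x ≠ none}

/-- The set `O_a` of variables observable by agent `a`,
given the typing `obs` of variables by their groups of observers. -/
def Obs (obs : Var → Set Agent) (a : Agent) : Set Var := {x | a ∈ obs x}

/-- Indistinguishability `s ≈_a s'`: the two states agree on every variable of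
`(dom(s) ∪ dom(s')) ∩ O_a` (agreement forces both values to be defined). -/
def indist (obs : Var → Set Agent) (a : Agent) (s s' : State Var D) : Prop :=
  ∀ x : Var, a ∈ obs x → x ∈ sdom s ∪ sdom s' → s x = s' x

/-- Terms of the quantifier-free base language `L_QF`. -/
inductive Tm (Var D : Type) where
  | var : Var → Tm Var D
  | const : D → Tm Var D
  | app : (D → D → D) → Tm Var D → Tm Var D → Tm Var D

namespace Tm

/-- Value `s(e)` of a term at a state (undefined if some variable is undefined). -/
def eval : Tm Var D → State Var D → Option D
  | .var x, s => s x
  | .const d, _ => some d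
  | .app f t u, s =>
      match t.eval s, u.eval s with
      | some a, some b => some (f a b)
      | _, _ => none

/-- Rename variable `x` into `k` in a term. -/
def rename [DecidableEq Var] (x k : Var) : Tm Var D → Tm Var D
  | .var y => .var (if y = x then k else y)
  | .const d => .const d
  | .app f t u => .app f (t.rename x k) (u.rename x k)

/-- Variables of a term. -/
def fv [DecidableEq Var] : Tm Var D → Finset Var
  | .var x => {x}
  | .const _ => ∅
  | .app _ t u => t.fv ∪ u.fv

end Tm

/-- Atoms of the quantifier-free base language `L_QF`: relations between two terms. -/
inductive BaseF (Var D : Type) where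
  | rel : (D → D → Prop) → Tm Var D → Tm Var D → BaseF Var D

namespace BaseF

/-- Truth `s ⊨_QF π` of a base atom at a state. -/
def sat (s : State Var D) : BaseF Var D → Prop
  | .rel r t u => ∃ a b, t.eval s = some a ∧ u.eval s = some b ∧ r a b

/-- Rename variable `x` into `k` in an atom. -/
def rename [DecidableEq Var] (x k : Var) : BaseF Var D → BaseF Var D
  | .rel r t u => .rel r (t.rename x k) (u.rename x k)

/-- Variables of an atom. -/
def fv [DecidableEq Var] : BaseF Var D → Finset Var
  | .rel _ t u => t.fv ∪ u.fv

end BaseF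

/-- The atom `x = e`. -/
def eqAtom (x : Var) (e : Tm Var D) : BaseF Var D := .rel (· = ·) (.var x) e

/-- The multi-agent epistemic language `L^m_K`:
`α ::= π | α ∧ α | ¬α | K_a α | [α']α | ∀x_G·α`. -/
inductive Form (Agent Var D : Type) where
  | atom : BaseF Var D → Form Agent Var D
  | conj : Form Agent Var D → Form Agent Var D → Form Agent Var D
  | neg : Form Agent Var D → Form Agent Var D
  | know : Agent → Form Agent Var D → Form Agent Var D
  | ann : Form Agent Var D → Form Agent Var D → Form Agent Var D
  | all : Var → Form Agent Var D → Form Agent Var D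

namespace Form

/-- Substitution `α[x\k]` of variable `k` for variable `x`. -/
def rename [DecidableEq Var] (x k : Var) : Form Agent Var D → Form Agent Var D
  | .atom π => .atom (π.rename x k)
  | .conj α β => .conj (α.rename x k) (β.rename x k)
  | .neg α => .neg (α.rename x k)
  | .know a α => .know a (α.rename x k)
  | .ann β α => .ann (β.rename x k) (α.rename x k)
  | .all y α => if y = x then .all y α else .all y (α.rename x k)

/-- Free variables `FV(α)`. -/
def fv [DecidableEq Var] : Form Agent Var D → Finset Var
  | .atom π => π.fv
  | .conj α β => α.fv ∪ β.fv
  | .neg α => α.fv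
  | .know _ α => α.fv
  | .ann β α => β.fv ∪ α.fv
  | .all y α => α.fv \ {y}

/-- All variables occurring in `α` (free or bound). -/
def vars [DecidableEq Var] : Form Agent Var D → Finset Var
  | .atom π => π.fv
  | .conj α β => α.vars ∪ β.vars
  | .neg α => α.vars
  | .know _ α => α.vars
  | .ann β α => β.vars ∪ α.vars
  | .all y α => insert y α.vars

end Form

/-- The augmented model `⋃_{d ∈ D} W[x ↦ d]`. -/
def aug [DecidableEq Var] (W : Set (State Var D)) (x : Var) : Set (State Var D) :=
  ⋃ d : D, (fun s => upd s x (some d)) '' W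

/-- Truth `(W, s) ⊨ α` of an `L^m_K` formula at a pointed model. -/
def truth [DecidableEq Var] (obs : Var → Set Agent) :
    Form Agent Var D → Set (State Var D) → State Var D → Prop
  | .atom π, _, s => π.sat s
  | .conj α β, W, s => truth obs α W s ∧ truth obs β W s
  | .neg α, W, s => ¬ truth obs α W s
  | .know a α, W, s => ∀ s' ∈ W, indist obs a s' s → truth obs α W s'
  | .ann β α, W, s => truth obs β W s → truth obs α {t | t ∈ W ∧ truth obs β W t} s
  | .all x α, W, s => ∀ c : D, truth obs α (aug W x) (upd s x (some c))

/-- Truth of a formula at a model: `W ⊨ α` iff `(W,s) ⊨ α` for every `s ∈ W`. -/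
def models [DecidableEq Var] (obs : Var → Set Agent)
    (W : Set (State Var D)) (α : Form Agent Var D) : Prop :=
  ∀ s ∈ W, truth obs α W s

/-- The programming language `C`:
`P ::= β? | x_G := e | new k_G·P | P;Q | P ⊔ Q`.
In `assign x e k`, `k` is the fresh variable recording the overwritten value of `x`;
in `choice P Q c`, `c` is the fresh variable (observable by all agents)
recording how the nondeterministic choice was resolved. -/
inductive Prog (Agent Var D : Type) where
  | test : Form Agent Var D → Prog Agent Var D
  | assign : Var → Tm Var D → Var → Prog Agent Var D
  | nu : Var → Prog Agent Var D → Prog Agent Var D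
  | seq : Prog Agent Var D → Prog Agent Var D → Prog Agent Var D
  | choice : Prog Agent Var D → Prog Agent Var D → Var → Prog Agent Var D

/-- State-relational semantics `R_W(P, s)` (with the two distinct values `l, r ∈ D`
marking left/right nondeterministic branches). -/
def R [DecidableEq Var] (obs : Var → Set Agent) (l r : D) :
    Prog Agent Var D → Set (State Var D) → State Var D → Set (State Var D)
  | .test β, W, s => {t | truth obs β W s ∧ t = s}
  | .assign x e k, _, s => {upd (upd s k (s x)) x (e.eval s)}
  | .nu k P, W, s => ⋃ d : D, R obs l r P W (upd s k (some d))
  | .seq P Q, W, s => ⋃ s' ∈ R obs l r P W s, R obs l r Q (⋃ t ∈ W, R obs l r P W t) s'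
  | .choice P Q c, W, s =>
      ((fun t => upd t c (some l)) '' R obs l r P W s) ∪
      ((fun t => upd t c (some r)) '' R obs l r Q W s)

/-- Post-image `R*_W(P, E) = ⋃_{t ∈ E} R_W(P, t)`. -/
def Rstar [DecidableEq Var] (obs : Var → Set Agent) (l r : D)
    (P : Prog Agent Var D) (W E : Set (State Var D)) : Set (State Var D) :=
  ⋃ t ∈ E, R obs l r P W t

/-- Model-relational semantics `F(P, W)`. -/
def F [DecidableEq Var] (obs : Var → Set Agent) (l r : D) :
    Prog Agent Var D → Set (State Var D) → Set (State Var D)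
  | .test β, W => {s | s ∈ W ∧ truth obs β W s}
  | .assign x e k, W => (fun s => upd (upd s k (s x)) x (e.eval s)) '' W
  | .nu k P, W => F obs l r P (aug W k)
  | .seq P Q, W => F obs l r Q (F obs l r P W)
  | .choice P Q c, W =>
      ((fun s => upd s c (some l)) '' F obs l r P W) ∪
      ((fun s => upd s c (some r)) '' F obs l r Q W)

/-- Weakest-precondition transformer `wp(P, ·) : L^m_K → L^m_K`. -/
def wp [DecidableEq Var] : Prog Agent Var D → Form Agent Var D → Form Agent Var D
  | .test β, α => .ann β α
  | .assign x e k, α => .all k (.ann (.atom (eqAtom k e)) (α.rename x k))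
  | .nu k P, α => .all k (wp P α)
  | .seq P Q, α => wp P (wp Q α)
  | .choice P Q _, α => .conj (wp P α) (wp Q α)

/-- The program-epistemic language `L_DK`: `L^m_K` extended with program modalities `□_P α`. -/
inductive DForm (Agent Var D : Type) where
  | atom : BaseF Var D → DForm Agent Var D
  | conj : DForm Agent Var D → DForm Agent Var D → DForm Agent Var D
  | neg : DForm Agent Var D → DForm Agent Var D
  | know : Agent → DForm Agent Var D → DForm Agent Var D
  | ann : DForm Agent Var D → DForm Agent Var D → DForm Agent Var D
  | box : Prog Agent Var D → DForm Agent Var D → DForm Agent Var D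
  | all : Var → DForm Agent Var D → DForm Agent Var D

/-- Embedding of `L^m_K` into `L_DK`. -/
def Form.toD : Form Agent Var D → DForm Agent Var D
  | .atom π => .atom π
  | .conj α β => .conj α.toD β.toD
  | .neg α => .neg α.toD
  | .know a α => .know a α.toD
  | .ann β α => .ann β.toD α.toD
  | .all x α => .all x α.toD

/-- Truth `(W, s) ⊨ α` of an `L_DK` formula at a pointed model;
`(W,s) ⊨ □_P α` iff for every `s' ∈ R_W(P,s)`, `(R*_W(P,W), s') ⊨ α`. -/
def truthD [DecidableEq Var] (obs : Var → Set Agent) (l r : D) :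
    DForm Agent Var D → Set (State Var D) → State Var D → Prop
  | .atom π, _, s => π.sat s
  | .conj α β, W, s => truthD obs l r α W s ∧ truthD obs l r β W s
  | .neg α, W, s => ¬ truthD obs l r α W s
  | .know a α, W, s => ∀ s' ∈ W, indist obs a s' s → truthD obs l r α W s'
  | .ann β α, W, s =>
      truthD obs l r β W s → truthD obs l r α {t | t ∈ W ∧ truthD obs l r β W t} s
  | .box P α, W, s => ∀ s' ∈ R obs l r P W s, truthD obs l r α (Rstar obs l r P W W) s'
  | .all x α, W, s => ∀ c : D, truthD obs l r α (aug W x) (upd s x (some c))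

/-- Truth of an `L_DK` formula at a model. -/
def dmodels [DecidableEq Var] (obs : Var → Set Agent) (l r : D)
    (W : Set (State Var D)) (α : DForm Agent Var D) : Prop :=
  ∀ s ∈ W, truthD obs l r α W s

/-- The first-order language `L_FO`: `φ ::= π | φ ∧ φ | ¬φ | ∀x_G·φ`. -/
inductive FOF (Var D : Type) where
  | atom : BaseF Var D → FOF Var D
  | conj : FOF Var D → FOF Var D → FOF Var D
  | neg : FOF Var D → FOF Var D
  | all : Var → FOF Var D → FOF Var D

namespace FOF

/-- Implication, defined from `¬` and `∧`. -/
def imp (φ ψ : FOF Var D) : FOF Var D := .neg (.conj φ (.neg ψ))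

/-- First-order truth `s ⊨_FO φ` at a state. -/
def sat [DecidableEq Var] : FOF Var D → State Var D → Prop
  | .atom π, s => π.sat s
  | .conj φ ψ, s => φ.sat s ∧ ψ.sat s
  | .neg φ, s => ¬ φ.sat s
  | .all x φ, s => ∀ c : D, (sat φ) (upd s x (some c) : State Var D)

/-- Free variables of a first-order formula. -/
def fv [DecidableEq Var] : FOF Var D → Finset Var
  | .atom π => π.fv
  | .conj φ ψ => φ.fv ∪ ψ.fv
  | .neg φ => φ.fv
  | .all x φ => φ.fv \ {x}

end FOF

/-- The satisfaction set `⟦φ⟧ = {s ∈ 𝒰 | s ⊨_FO φ}`. -/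
def interp [DecidableEq Var] (φ : FOF Var D) : Set (State Var D) := {s | φ.sat s}

/-- Universal quantification over a list of variables. -/
def forallL : List Var → FOF Var D → FOF Var D
  | [], φ => φ
  | x :: xs, φ => .all x (forallL xs φ)

open scoped Classical in
/-- The translation `τ : L_FO × L^m_K → L_FO`. -/
noncomputable def tauK [DecidableEq Var] (obs : Var → Set Agent) :
    FOF Var D → Form Agent Var D → FOF Var D
  | _, .atom π => .atom π
  | φ, .conj α β => .conj (tauK obs φ α) (tauK obs φ β)
  | φ, .neg α => .neg (tauK obs φ α)
  | φ, .know a α =>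
      forallL (((α.fv ∪ φ.fv).filter (fun x => a ∉ obs x)).toList)
        (FOF.imp φ (tauK obs φ α))
  | φ, .ann β α => FOF.imp (tauK obs φ β) (tauK obs (.conj φ (tauK obs φ β)) α)
  | φ, .all x α => .all x (tauK obs φ α)

/-- Elimination of program modalities via `wp`: `□_P α` becomes `wp(P, α)`. -/
def elimBox [DecidableEq Var] : DForm Agent Var D → Form Agent Var D
  | .atom π => .atom π
  | .conj α β => .conj (elimBox α) (elimBox β)
  | .neg α => .neg (elimBox α)
  | .know a α => .know a (elimBox α)
  | .ann β α => .ann (elimBox β) (elimBox α)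
  | .box P α => wp P (elimBox α)
  | .all x α => .all x (elimBox α)

/-- The translation `τ : L_FO × L_DK → L_FO`, with `τ(φ, □_P α) = τ(φ, wp(P, α))`. -/
noncomputable def tauD [DecidableEq Var] (obs : Var → Set Agent)
    (φ : FOF Var D) (α : DForm Agent Var D) : FOF Var D :=
  tauK obs φ (elimBox α)

/-- Renaming `x` into `k` inside a state. -/
def srename [DecidableEq Var] (x k : Var) (s : State Var D) : State Var D :=
  fun y => if y = k then s x else if y = x then none else s y

/-- Free variables of a program (variables recording overwritten values /
choice resolutions, and `new`-bound variables, are bound). -/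
def Prog.fv [DecidableEq Var] : Prog Agent Var D → Finset Var
  | .test β => β.fv
  | .assign x e _ => insert x e.fv
  | .nu k P => P.fv \ {k}
  | .seq P Q => P.fv ∪ Q.fv
  | .choice P Q _ => P.fv ∪ Q.fv

/-- Free variables of an `L_DK` formula. -/
def DForm.fv [DecidableEq Var] : DForm Agent Var D → Finset Var
  | .atom π => π.fv
  | .conj α β => α.fv ∪ β.fv
  | .neg α => α.fv
  | .know _ α => α.fv
  | .ann β α => β.fv ∪ α.fv
  | .box P α => P.fv ∪ α.fv
  | .all y α => α.fv \ {y}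

/-- Well-formedness of a program w.r.t. the set `p` of available (program) variables:
free variables of tests, assigned variables and terms are in `p`; the auxiliary
variables `k_G` (recording overwritten values, observable by the same group as the
assigned variable) and `c_Ag` (recording choice resolutions, observable by all agents)
are fresh. -/
def Prog.WF [DecidableEq Var] (obs : Var → Set Agent) :
    Set Var → Prog Agent Var D → Prop
  | p, .test β => ↑β.fv ⊆ p
  | p, .assign x e k => x ∈ p ∧ ↑e.fv ⊆ p ∧ k ∉ p ∧ obs k = obs x
  | p, .nu k P => k ∉ p ∧ Prog.WF obs (insert k p) P
  | p, .seq P Q => Prog.WF obs p P ∧ Prog.WF obs p Q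
  | p, .choice P Q c => Prog.WF obs p P ∧ Prog.WF obs p Q ∧ c ∉ p ∧ obs c = Set.univ

/-- Well-formedness of an `L_DK` formula: every program occurring in it is well-formed. -/
def DForm.WF [DecidableEq Var] (obs : Var → Set Agent) :
    Set Var → DForm Agent Var D → Prop
  | _, .atom _ => True
  | p, .conj α β => α.WF obs p ∧ β.WF obs p
  | p, .neg α => α.WF obs p
  | p, .know _ α => α.WF obs p
  | p, .ann β α => β.WF obs p ∧ α.WF obs p
  | p, .box P α => P.WF obs p ∧ α.WF obs p
  | p, .all x α => α.WF obs (insert x p)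


theorem upd_same [DecidableEq Var] (s : State Var D) (x : Var) (v : Option D) :
    upd s x v x = v := by simp [upd]

theorem upd_ne [DecidableEq Var] (s : State Var D) (x y : Var) (v : Option D) (h : y ≠ x) :
    upd s x v y = s y := by simp [upd, h]

theorem upd_comm [DecidableEq Var] (s : State Var D) (x y : Var) (v w : Option D) (h : x ≠ y) :
    upd (upd s x v) y w = upd (upd s y w) x v := by
  funext z
  unfold upd
  by_cases h1 : z = x <;> by_cases h2 : z = y <;> simp_all

theorem Tm.eval_upd [DecidableEq Var] (s : State Var D) (c : Var) (w : Option D)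
    (t : Tm Var D) (h : c ∉ t.fv) : t.eval (upd s c w) = t.eval s := by
  induction t with
  | var x =>
    have : x ≠ c := by rintro rfl; simp [Tm.fv] at h
    simp [Tm.eval, upd, this]
  | const d => rfl
  | app f t u iht ihu =>
    simp only [Tm.fv, Finset.mem_union, not_or] at h
    simp only [Tm.eval, iht h.1, ihu h.2]

theorem BaseF.sat_upd [DecidableEq Var] (s : State Var D) (c : Var) (w : Option D)
    (p : BaseF Var D) (h : c ∉ p.fv) : p.sat (upd s c w) ↔ p.sat s := by
  cases p with
  | rel r t u =>
    simp only [BaseF.fv, Finset.mem_union, not_or] at h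
    simp only [BaseF.sat, Tm.eval_upd s c w _ h.1, Tm.eval_upd s c w _ h.2]

theorem indist_all {obs : Var → Set Agent} {a : Agent} {s s' : State Var D} :
    indist obs a s s' ↔ ∀ x, a ∈ obs x → s x = s' x := by
  constructor
  · intro h x hx
    by_cases hd : x ∈ sdom s ∪ sdom s'
    · exact h x hx hd
    · simp only [sdom, Set.mem_union, Set.mem_setOf_eq, not_or, not_not] at hd
      rw [hd.1, hd.2]
  · intro h x hx _
    exact h x hx

/-- Truth only depends on the part of the model agreeing on a commonly observed variable. -/
theorem truth_restrict [DecidableEq Var] (obs : Var → Set Agent) (c : Var)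
    (hc : obs c = Set.univ) (α : Form Agent Var D) (hα : c ∉ α.vars) :
    ∀ (W : Set (State Var D)) (v : Option D) (s : State Var D), s c = v →
      (truth obs α W s ↔ truth obs α {t | t ∈ W ∧ t c = v} s) := by
  induction α with
  | atom p => intros; simp only [truth]
  | conj α β iha ihb =>
    simp only [Form.vars, Finset.mem_union, not_or] at hα
    intro W v s hs
    simp only [truth]
    rw [iha hα.1 W v s hs, ihb hα.2 W v s hs]
  | neg α iha =>
    intro W v s hs
    simp only [truth]
    rw [iha hα W v s hs]
  | know a α iha =>
    intro W v s hs
    simp only [truth]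
    constructor
    · rintro h t ⟨ht, htc⟩ hi
      exact (iha hα W v t htc).1 (h t ht hi)
    · intro h t ht hi
      have htc : t c = v := by
        rw [← hs]; exact indist_all.1 hi c (by rw [hc]; trivial)
      exact (iha hα W v t htc).2 (h t ⟨ht, htc⟩ hi)
  | ann β α ihb iha =>
    simp only [Form.vars, Finset.mem_union, not_or] at hα
    intro W v s hs
    simp only [truth]
    rw [← ihb hα.1 W v s hs, iha hα.2 _ v s hs]
    have : {t | t ∈ {t | t ∈ W ∧ truth obs β W t} ∧ t c = v} =
        {t | t ∈ {t | t ∈ W ∧ t c = v} ∧ truth obs β {t | t ∈ W ∧ t c = v} t} := by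
      ext t
      simp only [Set.mem_setOf_eq]
      constructor
      · rintro ⟨⟨h1, h2⟩, h3⟩
        exact ⟨⟨h1, h3⟩, (ihb hα.1 W v t h3).1 h2⟩
      · rintro ⟨⟨h1, h3⟩, h2⟩
        exact ⟨⟨h1, (ihb hα.1 W v t h3).2 h2⟩, h3⟩
    rw [this]
  | all x α iha =>
    simp only [Form.vars, Finset.mem_insert, not_or] at hα
    intro W v s hs
    simp only [truth]
    refine forall_congr' fun d => ?_
    rw [iha hα.2 (aug W x) v _ (by rw [upd_ne _ _ _ _ hα.1]; exact hs)]
    have : {t | t ∈ aug W x ∧ t c = v} = aug {t | t ∈ W ∧ t c = v} x := by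
      ext t
      simp only [aug, Set.mem_setOf_eq, Set.mem_iUnion, Set.mem_image]
      constructor
      · rintro ⟨⟨e, u, hu, rfl⟩, h⟩
        rw [upd_ne _ _ _ _ hα.1] at h
        exact ⟨e, u, ⟨hu, h⟩, rfl⟩
      · rintro ⟨e, u, ⟨hu, h⟩, rfl⟩
        exact ⟨⟨e, u, hu, rfl⟩, by rw [upd_ne _ _ _ _ hα.1]; exact h⟩
    rw [this]

/-- Changing the constant value of a non-occurring variable preserves truth. -/
theorem truth_upd [DecidableEq Var] (obs : Var → Set Agent) (c : Var) (v w : Option D)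
    (α : Form Agent Var D) (hα : c ∉ α.vars) :
    ∀ (W : Set (State Var D)) (s : State Var D), (∀ t ∈ W, t c = v) → s c = v →
      (truth obs α ((fun t => upd t c w) '' W) (upd s c w) ↔ truth obs α W s) := by
  induction α with
  | atom p =>
    intro W s _ _
    simp only [truth]
    exact BaseF.sat_upd s c w p hα
  | conj α β iha ihb =>
    simp only [Form.vars, Finset.mem_union, not_or] at hα
    intro W s hW hs
    simp only [truth]
    rw [iha hα.1 W s hW hs, ihb hα.2 W s hW hs]
  | neg α iha =>
    intro W s hW hs
    simp only [truth]
    rw [iha hα W s hW hs]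
  | know a α iha =>
    intro W s hW hs
    simp only [truth, Set.forall_mem_image]
    refine forall_congr' fun t => forall_congr' fun ht => ?_
    rw [iha hα W t hW (hW t ht)]
    have : indist obs a (upd t c w) (upd s c w) ↔ indist obs a t s := by
      rw [indist_all, indist_all]
      refine forall_congr' fun x => forall_congr' fun _ => ?_
      by_cases hx : x = c
      · subst hx
        simp [upd_same, hs, hW t ht]
      · rw [upd_ne _ _ _ _ hx, upd_ne _ _ _ _ hx]
    rw [this]
  | ann β α ihb iha =>
    simp only [Form.vars, Finset.mem_union, not_or] at hα
    intro W s hW hs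
    simp only [truth]
    rw [ihb hα.1 W s hW hs, ← iha hα.2 {t | t ∈ W ∧ truth obs β W t} s (fun t ht => hW t ht.1) hs]
    have : {t | t ∈ (fun t => upd t c w) '' W ∧ truth obs β ((fun t => upd t c w) '' W) t} =
        (fun t => upd t c w) '' {t | t ∈ W ∧ truth obs β W t} := by
      ext t
      simp only [Set.mem_setOf_eq, Set.mem_image]
      constructor
      · rintro ⟨⟨u, hu, rfl⟩, h⟩
        exact ⟨u, ⟨hu, (ihb hα.1 W u hW (hW u hu)).1 h⟩, rfl⟩
      · rintro ⟨u, ⟨hu, h⟩, rfl⟩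
        exact ⟨⟨u, hu, rfl⟩, (ihb hα.1 W u hW (hW u hu)).2 h⟩
    rw [this]
  | all x α iha =>
    simp only [Form.vars, Finset.mem_insert, not_or] at hα
    intro W s hW hs
    simp only [truth]
    refine forall_congr' fun d => ?_
    have hA : ∀ t ∈ aug W x, t c = v := by
      intro t ht
      simp only [aug, Set.mem_iUnion, Set.mem_image] at ht
      obtain ⟨e, u, hu, rfl⟩ := ht
      rw [upd_ne _ _ _ _ hα.1]
      exact hW u hu
    rw [← iha hα.2 (aug W x) (upd s x (some d)) hA (by rw [upd_ne _ _ _ _ hα.1]; exact hs)]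
    have : aug ((fun t => upd t c w) '' W) x = (fun t => upd t c w) '' aug W x := by
      simp only [aug, Set.image_iUnion, Set.image_image]
      refine Set.iUnion_congr fun e => Set.image_congr fun u _ => ?_
      exact upd_comm u c x _ _ hα.1
    rw [this, upd_comm s c x _ _ hα.1]

theorem models_upd [DecidableEq Var] (obs : Var → Set Agent) (c : Var) (w : Option D)
    (α : Form Agent Var D) (hα : c ∉ α.vars) (W : Set (State Var D))
    (hW : ∀ t ∈ W, t c = none) :
    models obs ((fun t => upd t c w) '' W) α ↔ models obs W α := by
  simp only [models, Set.forall_mem_image]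
  exact forall_congr' fun t => forall_congr' fun ht =>
    truth_upd obs c none w α hα W t hW (hW t ht)

/-- Let `c` be a variable observable by all agents, not in
`dom(W₁) ∪ dom(W₂)`, and `l ≠ r` two values of `D`. For
`W = {s[c ↦ l] | s ∈ W₁} ∪ {s[c ↦ r] | s ∈ W₂}` and any `α ∈ L^m_K` in which `c`
does not occur: `W ⊨ α` iff both halves satisfy `α`, which in turn holds iff
`W₁ ⊨ α` and `W₂ ⊨ α` (disjoint union preserves truth of epistemic formulas). -/
theorem disjoint_union_preserves {Agent Var D : Type} [DecidableEq Var]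
    (obs : Var → Set Agent) (W₁ W₂ : Set (State Var D)) (c : Var) (l r : D)
    (hc : obs c = Set.univ) (hdom : ∀ s ∈ W₁ ∪ W₂, c ∉ sdom s) (hlr : l ≠ r)
    (α : Form Agent Var D) (hα : c ∉ α.vars) :
    (models obs (((fun s => upd s c (some l)) '' W₁) ∪
        ((fun s => upd s c (some r)) '' W₂)) α ↔
      (models obs ((fun s => upd s c (some l)) '' W₁) α ∧
        models obs ((fun s => upd s c (some r)) '' W₂) α)) ∧
    ((models obs ((fun s => upd s c (some l)) '' W₁) α ∧
        models obs ((fun s => upd s c (some r)) '' W₂) α) ↔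
      (models obs W₁ α ∧ models obs W₂ α)) := by
  have hd : ∀ s ∈ W₁ ∪ W₂, s c = none := fun s hs => not_not.1 (hdom s hs)
  refine ⟨?_, and_congr
    (models_upd obs c _ α hα W₁ fun t ht => hd t (Or.inl ht))
    (models_upd obs c _ α hα W₂ fun t ht => hd t (Or.inr ht))⟩
  set A := (fun s => upd s c (some l)) '' W₁ with hA
  set B := (fun s => upd s c (some r)) '' W₂ with hB
  have hAc : ∀ t ∈ A, t c = some l := by
    rintro t ⟨u, _, rfl⟩; exact upd_same _ _ _
  have hBc : ∀ t ∈ B, t c = some r := by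
    rintro t ⟨u, _, rfl⟩; exact upd_same _ _ _
  have eA : {t | t ∈ A ∪ B ∧ t c = some l} = A := by
    ext t
    constructor
    · rintro ⟨h | h, h2⟩
      · exact h
      · rw [hBc t h] at h2
        exact absurd (Option.some.inj h2).symm hlr
    · exact fun h => ⟨Or.inl h, hAc t h⟩
  have eB : {t | t ∈ A ∪ B ∧ t c = some r} = B := by
    ext t
    constructor
    · rintro ⟨h | h, h2⟩
      · rw [hAc t h] at h2
        exact absurd (Option.some.inj h2) hlr
      · exact h
    · exact fun h => ⟨Or.inr h, hBc t h⟩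
  have kA : ∀ t ∈ A, (truth obs α (A ∪ B) t ↔ truth obs α A t) := fun t ht => by
    rw [truth_restrict obs c hc α hα (A ∪ B) _ t (hAc t ht), eA]
  have kB : ∀ t ∈ B, (truth obs α (A ∪ B) t ↔ truth obs α B t) := fun t ht => by
    rw [truth_restrict obs c hc α hα (A ∪ B) _ t (hBc t ht), eB]
  constructor
  · intro h
    exact ⟨fun t ht => (kA t ht).1 (h t (Or.inl ht)), fun t ht => (kB t ht).1 (h t (Or.inr ht))⟩
  · rintro ⟨h1, h2⟩ t (ht | ht)
    · exact (kA t ht).2 (h1 t ht)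
    · exact (kB t ht).2 (h2 t ht)

end PEL
end

section
/- Let W ⊆ 𝒰 with x_G ∈ dom(W), k_G ∉ dom(W) a fresh variable observable by the same group G, and e an L_QF term over dom(W). Let W_{x_G\k_G} be the model obtained by renaming x_G into k_G in every state of W, and e[x_G\k_G] the term e with x_G replaced by k_G. Then F(x_G := e, W) = F(new x_G·(x_G = e[x_G\k_G])?, W_{x_G\k_G}); that is, assigning e to x_G is the same as renaming the old x_G into k_G, declaring a new variable x_G, and testing that it equals e with the old value substituted. -/
namespace PEL

variable {Agent Var D : Type}

theorem eval_rename_aux [DecidableEq Var] (s : State Var D) (x k : Var) (d : Option D)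
    (hxk : k ≠ x) (hks : k ∉ sdom s) (e : Tm Var D) (he : ↑e.fv ⊆ sdom s) :
    (e.rename x k).eval (upd (srename x k s) x d) = e.eval s ∧ ∃ v, e.eval s = some v := by
  induction e with
  | var y =>
    have hy : y ∈ sdom s := he (by simp [Tm.fv])
    have hyk : y ≠ k := fun h => hks (h ▸ hy)
    refine ⟨?_, Option.ne_none_iff_exists'.mp hy⟩
    by_cases h : y = x
    · subst h
      simp [Tm.rename, Tm.eval, upd, srename, hxk]
    · simp [Tm.rename, Tm.eval, upd, srename, h, hyk]
  | const c => exact ⟨rfl, c, rfl⟩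
  | app f t u iht ihu =>
    have h1 := iht (fun y hy => he (by simp [Tm.fv] at hy ⊢; exact Or.inl hy))
    have h2 := ihu (fun y hy => he (by simp [Tm.fv] at hy ⊢; exact Or.inr hy))
    obtain ⟨h1, a, ha⟩ := h1
    obtain ⟨h2, b, hb⟩ := h2
    simp [Tm.rename, Tm.eval, h1, h2, ha, hb]

theorem upd_srename_aux [DecidableEq Var] (s : State Var D) (x k : Var) (d : Option D) :
    upd (srename x k s) x d = upd (upd s k (s x)) x d := by
  funext y
  simp only [upd, srename]
  split_ifs <;> rfl

/-- For `x ∈ dom(W)`, a fresh `k ∉ dom(W)` observable by the same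
group as `x`, and a term `e` over `dom(W)`:
`F(x := e, W) = F(new x·(x = e[x\k])?, W_{x\k})`. -/
theorem F_assign_eq_new_test {Agent Var D : Type} [DecidableEq Var]
    (obs : Var → Set Agent) (l r : D) (W : Set (State Var D))
    (x k : Var) (e : Tm Var D)
    (hx : ∀ s ∈ W, x ∈ sdom s) (hk : ∀ s ∈ W, k ∉ sdom s)
    (hobs : obs k = obs x) (he : ∀ s ∈ W, ↑e.fv ⊆ sdom s) :
    F obs l r (.assign x e k) W =
      F obs l r (.nu x (.test (.atom (eqAtom x (e.rename x k)))))
        (srename x k '' W) := by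
  have key : ∀ s ∈ W, ∀ d : Option D,
      (e.rename x k).eval (upd (srename x k s) x d) = e.eval s ∧ ∃ v, e.eval s = some v := by
    intro s hs d
    exact eval_rename_aux s x k d (fun h => hk s hs (h ▸ hx s hs)) (hk s hs) e (he s hs)
  ext t
  simp only [F, aug, truth, eqAtom, BaseF.sat, Set.mem_image, Set.mem_iUnion, Set.mem_setOf_eq]
  constructor
  · rintro ⟨s, hs, rfl⟩
    obtain ⟨v, hv⟩ := (key s hs none).2
    rw [hv, ← upd_srename_aux]
    refine ⟨⟨v, _, ⟨s, hs, rfl⟩, rfl⟩, v, v, ?_, ?_, rfl⟩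
    · simp [Tm.eval, upd]
    · rw [(key s hs _).1, hv]
  · rintro ⟨⟨d, _, ⟨s, hs, rfl⟩, rfl⟩, a, b, ha, hb, hab⟩
    refine ⟨s, hs, ?_⟩
    rw [(key s hs _).1] at hb
    have ha' : d = a := by simpa [Tm.eval, upd] using ha
    rw [hb, ← hab, ← ha', upd_srename_aux]

end PEL
end

section
/- For every n ≥ 1 and Booleans p_0, …, p_{n-1} and c_0, …, c_{n-1}, if at most one of the p_i is true (i.e., for each i, p_i implies ¬p_j for all j ≠ i), then the XOR over i = 0, …, n−1 of (p_i XOR c_{(i−1) mod n} XOR c_{i}) equals the disjunction p_0 ∨ ⋯ ∨ p_{n-1}; that is, in the Dining Cryptographers protocol, the XOR of all announcements (each cryptographer XORing whether they paid with the two adjacent coins) equals whether some cryptographer paid. -/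
theorem foldr_xor_split {α : Type*} (f g : α → Bool) (l : List α) :
    (l.map (fun i => Bool.xor (f i) (g i))).foldr Bool.xor false
      = Bool.xor ((l.map f).foldr Bool.xor false) ((l.map g).foldr Bool.xor false) := by
  induction l with
  | nil => rfl
  | cons a l ih =>
    simp only [List.map_cons, List.foldr_cons, ih]
    generalize (l.map f).foldr Bool.xor false = x
    generalize (l.map g).foldr Bool.xor false = y
    generalize f a = u
    generalize g a = v
    revert x y u v
    decide

theorem foldr_all_false {α : Type*} (p : α → Bool) (l : List α) (h : ∀ j ∈ l, p j = false) :
    (l.map p).foldr Bool.xor false = false ∧ (l.map p).foldr (· || ·) false = false := by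
  induction l with
  | nil => exact ⟨rfl, rfl⟩
  | cons a l ih =>
    obtain ⟨h1, h2⟩ := ih (fun j hj => h j (List.mem_cons_of_mem _ hj))
    have ha := h a List.mem_cons_self
    simp only [List.map_cons, List.foldr_cons, h1, h2, ha]
    decide

theorem foldr_xor_eq_or {α : Type*} (p : α → Bool)
    (h : ∀ i, p i = true → ∀ j, j ≠ i → p j = false) (l : List α) (hl : l.Nodup) :
    (l.map p).foldr Bool.xor false = (l.map p).foldr (· || ·) false := by
  induction l with
  | nil => rfl
  | cons a l ih =>
    rw [List.nodup_cons] at hl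
    simp only [List.map_cons, List.foldr_cons]
    cases ha : p a with
    | false => rw [ih hl.2]; simp
    | true =>
      obtain ⟨h1, h2⟩ := foldr_all_false p l
        (fun j hj => h a ha j (fun e => hl.1 (e ▸ hj)))
      rw [h1, h2]; rfl

theorem foldr_xor_shift (n : ℕ) [NeZero n] (c : Fin n → Bool) :
    ((List.finRange n).map (fun i => c (i - 1))).foldr Bool.xor false
      = ((List.finRange n).map c).foldr Bool.xor false := by
  have hp : ((List.finRange n).map (fun i => i - 1)).Perm (List.finRange n) := by
    refine (List.perm_ext_iff_of_nodup
      ((List.nodup_finRange n).map (Equiv.subRight (1 : Fin n)).injective)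
      (List.nodup_finRange n)).2 ?_
    intro a
    simp only [List.mem_map, List.mem_finRange, true_and, iff_true]
    exact (Equiv.subRight (1 : Fin n)).surjective a
  have : Std.Commutative Bool.xor := ⟨by decide⟩
  have : Std.Associative Bool.xor := ⟨by decide⟩
  have := (hp.map c).foldr_op_eq (op := Bool.xor) (a := false)
  rwa [List.map_map] at this

/-- For `n ≥ 1` cryptographers in a ring, if at most one of the
`p i` is true, then the XOR over `i` of the announcements
`p i XOR c (i-1) XOR c i` (indices mod `n`) equals the disjunction of the `p i`:
the XOR of all announcements reveals whether some cryptographer paid. -/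
theorem dining_cryptographers (n : ℕ) [NeZero n] (p c : Fin n → Bool)
    (h : ∀ i, p i = true → ∀ j, j ≠ i → p j = false) :
    ((List.finRange n).map
        (fun i => Bool.xor (p i) (Bool.xor (c (i - 1)) (c i)))).foldr Bool.xor false
      = ((List.finRange n).map p).foldr (· || ·) false := by
  rw [foldr_xor_split p, foldr_xor_split (fun i => c (i - 1)) c, foldr_xor_shift,
    Bool.xor_self, Bool.xor_false]
  exact foldr_xor_eq_or p h _ (List.nodup_finRange n)
end
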